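/- Flat systems are locally reachable: let f be flat along a trajectory (x̄,ū) and submersive along (x̄,ū). Then there exists r ∈ ℕ such that for all k_i ∈ ℤ and all k_f ≥ k_i + r there exist open neighborhoods W_i of x̄(k_i) and W_f of x̄(k_f) in ℝ^n such that for every x_i ∈ W_i and every x_f ∈ W_f there is a trajectory (x,u) of f with x(k_i) = x_i and x(k_f) = x_f. -/

import Mathlib

open Filter Topology

noncomputable section

/-- `Vec d` is the state/input space `ℝ^d`. -/
abbrev Vec (d : ℕ) : Type := Fin d → ℝ

/-- A trajectory of the time-varying discrete-time system `x⁺ = f(k,x,u)`. -/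
def IsTrajectory (n m : ℕ) (f : ℤ → Vec n → Vec m → Vec n)
    (x : ℤ → Vec n) (u : ℤ → Vec m) : Prop :=
  ∀ k : ℤ, x (k + 1) = f k (x k) (u k)

/-- A trajectory of the linearization of `f` along the trajectory `(xb, ub)`:
`Δx(k+1) = A(k) Δx(k) + B(k) Δu(k)` with `A(k) = D_x f(k, xb k, ub k)`,
`B(k) = D_u f(k, xb k, ub k)`. -/
def IsLinTrajectory (n m : ℕ) (f : ℤ → Vec n → Vec m → Vec n)
    (xb : ℤ → Vec n) (ub : ℤ → Vec m)
    (Δx : ℤ → Vec n) (Δu : ℤ → Vec m) : Prop :=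
  ∀ k : ℤ, Δx (k + 1) =
    fderiv ℝ (fun x => f k x (ub k)) (xb k) (Δx k) +
    fderiv ℝ (fun u => f k (xb k) u) (ub k) (Δu k)

/-- The window `W_k^{q₁,q₂}(x,u) = ((x(k-q₁),u(k-q₁)),…,(x(k+q₂),u(k+q₂)))`. -/
def pairWin (n m q₁ q₂ : ℕ) (x : ℤ → Vec n) (u : ℤ → Vec m) (k : ℤ) :
    Fin (q₁ + q₂ + 1) → Vec n × Vec m :=
  fun i => (x (k - q₁ + (i : ℕ)), u (k - q₁ + (i : ℕ)))

/-- The window `W_k^{r₁,r₂}(y) = (y(k-r₁),…,y(k+r₂))`. -/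
def seqWin (m r₁ r₂ : ℕ) (y : ℤ → Vec m) (k : ℤ) :
    Fin (r₁ + r₂ + 1) → Vec m :=
  fun i => y (k - r₁ + (i : ℕ))

/-- The data `(q₁,q₂,r₁,r₂,U,V,Φ,F)` witnessing flatness of the system `f`
along the trajectory `(xb, ub)`, conditions (F1)–(F4). -/
structure FlatData (n m : ℕ) (f : ℤ → Vec n → Vec m → Vec n)
    (xb : ℤ → Vec n) (ub : ℤ → Vec m) (q₁ q₂ r₁ r₂ : ℕ)
    (U : Set (Fin (q₁ + q₂ + 1) → Vec n × Vec m))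
    (V : Set (Fin (r₁ + r₂ + 1) → Vec m))
    (Φ : ℤ → (Fin (q₁ + q₂ + 1) → Vec n × Vec m) → Vec m)
    (F : ℤ → (Fin (r₁ + r₂ + 1) → Vec m) → Vec n × Vec m) : Prop where
  traj : IsTrajectory n m f xb ub
  openU : IsOpen U
  openV : IsOpen V
  smoothPhi : ∀ k : ℤ, ContDiffOn ℝ (⊤ : ℕ∞) (Φ k) U
  smoothF : ∀ k : ℤ, ContDiffOn ℝ (⊤ : ℕ∞) (F k) V
  /-- (F1), first half: the reference windows lie in `U`. -/
  memU : ∀ k : ℤ, pairWin n m q₁ q₂ xb ub k ∈ U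
  /-- (F1), second half: the windows of the reference flat output lie in `V`. -/
  memV : ∀ k : ℤ,
    seqWin m r₁ r₂ (fun j => Φ j (pairWin n m q₁ q₂ xb ub j)) k ∈ V
  /-- (F2): the parameterization satisfies the system equations. -/
  F2 : ∀ (k : ℤ) (y : ℤ → Vec m),
    seqWin m r₁ r₂ y k ∈ V → seqWin m r₁ r₂ y (k + 1) ∈ V →
    (F (k + 1) (seqWin m r₁ r₂ y (k + 1))).1 =
      f k (F k (seqWin m r₁ r₂ y k)).1 (F k (seqWin m r₁ r₂ y k)).2
  /-- (F3): `Φ` is a left inverse of the parameterization. -/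
  F3 : ∀ (k : ℤ) (y : ℤ → Vec m),
    (∀ j : ℤ, k - q₁ ≤ j → j ≤ k + q₂ → seqWin m r₁ r₂ y j ∈ V) →
    (fun i : Fin (q₁ + q₂ + 1) =>
        F (k - q₁ + (i : ℕ)) (seqWin m r₁ r₂ y (k - q₁ + (i : ℕ)))) ∈ U →
    Φ k (fun i : Fin (q₁ + q₂ + 1) =>
        F (k - q₁ + (i : ℕ)) (seqWin m r₁ r₂ y (k - q₁ + (i : ℕ)))) = y k
  /-- (F4): `F` recovers a solution from the values of its flat output. -/
  F4 : ∀ (k : ℤ) (x : ℤ → Vec n) (u : ℤ → Vec m),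
    (∀ j : ℤ, k - r₁ - q₁ ≤ j → j < k + r₂ + q₂ → x (j + 1) = f j (x j) (u j)) →
    (∀ j : ℤ, k - r₁ ≤ j → j ≤ k + r₂ → pairWin n m q₁ q₂ x u j ∈ U) →
    seqWin m r₁ r₂ (fun j => Φ j (pairWin n m q₁ q₂ x u j)) k ∈ V →
    (x k, u k) = F k (seqWin m r₁ r₂ (fun j => Φ j (pairWin n m q₁ q₂ x u j)) k)

/-- The reference flat-output trajectory `ȳ(k) = Φ(k, W_k^{q₁,q₂}(x̄,ū))`. -/
def refOut (n m q₁ q₂ : ℕ) (Φ : ℤ → (Fin (q₁ + q₂ + 1) → Vec n × Vec m) → Vec m)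
    (xb : ℤ → Vec n) (ub : ℤ → Vec m) : ℤ → Vec m :=
  fun k => Φ k (pairWin n m q₁ q₂ xb ub k)

/-- The system `f` is flat along the trajectory `(xb, ub)`. -/
def IsFlatAlong (n m : ℕ) (f : ℤ → Vec n → Vec m → Vec n)
    (xb : ℤ → Vec n) (ub : ℤ → Vec m) : Prop :=
  ∃ (q₁ q₂ r₁ r₂ : ℕ) (U : Set (Fin (q₁ + q₂ + 1) → Vec n × Vec m))
    (V : Set (Fin (r₁ + r₂ + 1) → Vec m))
    (Φ : ℤ → (Fin (q₁ + q₂ + 1) → Vec n × Vec m) → Vec m)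
    (F : ℤ → (Fin (r₁ + r₂ + 1) → Vec m) → Vec n × Vec m),
    FlatData n m f xb ub q₁ q₂ r₁ r₂ U V Φ F

/-- `f` is submersive along `(xb, ub)`: the Jacobian of `f(k,·,·)` at
`(xb k, ub k)` is surjective for every `k`. -/
def IsSubmersiveAlong (n m : ℕ) (f : ℤ → Vec n → Vec m → Vec n)
    (xb : ℤ → Vec n) (ub : ℤ → Vec m) : Prop :=
  ∀ k : ℤ, Function.Surjective
    ⇑(fderiv ℝ (Function.uncurry (f k)) (xb k, ub k))


/-- `z` satisfies the system equations on the time range `a ≤ j < b`. -/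
def SolvesOn {n m : ℕ} (f : ℤ → Vec n → Vec m → Vec n) (z : ℤ → Vec n × Vec m)
    (a b : ℤ) : Prop :=
  ∀ j : ℤ, a ≤ j → j < b → (z (j + 1)).1 = f j (z j).1 (z j).2

/-- A submersive system maps every neighborhood of the reference point onto a neighborhood
of the next reference state. -/
theorem IsSubmersiveAlong.map_nhds {n m : ℕ} {f : ℤ → Vec n → Vec m → Vec n}
    (hf : ∀ k : ℤ, ContDiff ℝ (⊤ : ℕ∞) (Function.uncurry (f k)))
    {xb : ℤ → Vec n} {ub : ℤ → Vec m} (hsub : IsSubmersiveAlong n m f xb ub) (k : ℤ) :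
    map (Function.uncurry (f k)) (𝓝 (xb k, ub k)) = 𝓝 (f k (xb k) (ub k)) := by
  have h : HasStrictFDerivAt (Function.uncurry (f k))
      (fderiv ℝ (Function.uncurry (f k)) (xb k, ub k)) (xb k, ub k) :=
    (hf k).contDiffAt.hasStrictFDerivAt (by simp)
  exact h.map_nhds_eq_of_surj (LinearMap.range_eq_top.2 (hsub k))

/-- Through every point near the reference point at time `k` there passes a solution on
`[k - d, k)` which stays near the reference. -/
theorem IsSubmersiveAlong.eventually_exists_solvesOn_backward {n m : ℕ}
    {f : ℤ → Vec n → Vec m → Vec n}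
    (hf : ∀ k : ℤ, ContDiff ℝ (⊤ : ℕ∞) (Function.uncurry (f k)))
    {xb : ℤ → Vec n} {ub : ℤ → Vec m} (htraj : IsTrajectory n m f xb ub)
    (hsub : IsSubmersiveAlong n m f xb ub) (d : ℕ) :
    ∀ (k : ℤ), ∀ N ∈ 𝓝 (fun j => (xb j, ub j)),
      ∀ᶠ w in 𝓝 (xb k, ub k), ∃ z ∈ N, z k = w ∧ SolvesOn f z (k - d) k := by
  induction d with
  | zero =>
    intro k N hN
    have hc : Tendsto (fun w => Function.update (fun j => (xb j, ub j)) k w)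
        (𝓝 (xb k, ub k)) (𝓝 (fun j => (xb j, ub j))) := by
      have h : Continuous fun w => Function.update (fun j => (xb j, ub j)) k w :=
        continuous_const.update k continuous_id
      simpa using h.tendsto (xb k, ub k)
    filter_upwards [hc hN] with w hw
    exact ⟨_, hw, by simp, fun j h₁ h₂ => by simp at h₁; omega⟩
  | succ d ih =>
    intro k N hN
    obtain ⟨k, rfl⟩ : ∃ l : ℤ, k = l + 1 := ⟨k - 1, by ring⟩
    have hc : Tendsto (fun p : (ℤ → Vec n × Vec m) × (Vec n × Vec m) =>
          Function.update p.1 (k + 1) p.2)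
        (𝓝 (fun j => (xb j, ub j)) ×ˢ 𝓝 (xb (k + 1), ub (k + 1)))
        (𝓝 (fun j => (xb j, ub j))) := by
      have h : Continuous fun p : (ℤ → Vec n × Vec m) × (Vec n × Vec m) =>
          Function.update p.1 (k + 1) p.2 := continuous_fst.update (k + 1) continuous_snd
      have hlim := h.tendsto ((fun j => (xb j, ub j)), (xb (k + 1), ub (k + 1)))
      rw [nhds_prod_eq] at hlim
      simpa using hlim
    obtain ⟨N₁, hN₁, N₂, hN₂, hsubset⟩ := mem_prod_iff.1 (hc hN)
    have hpre : ∀ᶠ x in 𝓝 (xb (k + 1)), ∃ w' : Vec n × Vec m,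
        (∃ z ∈ N₁, z k = w' ∧ SolvesOn f z (k - d) k) ∧ f k w'.1 w'.2 = x := by
      rw [htraj k, ← hsub.map_nhds hf k, eventually_map]
      filter_upwards [ih k N₁ hN₁] with w' hw'
      exact ⟨w', hw', rfl⟩
    filter_upwards [continuous_fst.continuousAt.eventually hpre, hN₂] with w hw hw₂
    obtain ⟨_, ⟨z, hz, rfl, hsol⟩, hx⟩ := hw
    refine ⟨Function.update z (k + 1) w, hsubset (Set.mk_mem_prod hz hw₂), by simp, ?_⟩
    intro j h₁ h₂
    have hj : j ≠ k + 1 := by omega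
    rcases eq_or_ne j k with rfl | hjk
    · simp [hx]
    · have hj' : j + 1 ≠ k + 1 := by omega
      rw [Function.update_of_ne hj, Function.update_of_ne hj']
      exact hsol j (by push_cast at h₁; omega) (by omega)

/-- Through every point near the reference point at time `k` there passes a solution on
`[k - d, k + e)` which stays near the reference. -/
theorem IsSubmersiveAlong.eventually_exists_solvesOn {n m : ℕ}
    {f : ℤ → Vec n → Vec m → Vec n}
    (hf : ∀ k : ℤ, ContDiff ℝ (⊤ : ℕ∞) (Function.uncurry (f k)))
    {xb : ℤ → Vec n} {ub : ℤ → Vec m} (htraj : IsTrajectory n m f xb ub)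
    (hsub : IsSubmersiveAlong n m f xb ub) (k : ℤ) (d e : ℕ) :
    ∀ N ∈ 𝓝 (fun j => (xb j, ub j)),
      ∀ᶠ w in 𝓝 (xb k, ub k), ∃ z ∈ N, z k = w ∧ SolvesOn f z (k - d) (k + e) := by
  induction e with
  | zero => simpa using hsub.eventually_exists_solvesOn_backward hf htraj d k
  | succ e ih =>
    intro N hN
    have hc : Tendsto (fun z : ℤ → Vec n × Vec m => Function.update z (k + e + 1)
          (Function.uncurry (f (k + e)) (z (k + e)), ub (k + e + 1)))
        (𝓝 (fun j => (xb j, ub j))) (𝓝 (fun j => (xb j, ub j))) := by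
      have h : Continuous fun z : ℤ → Vec n × Vec m => Function.update z (k + e + 1)
          (Function.uncurry (f (k + e)) (z (k + e)), ub (k + e + 1)) :=
        continuous_id.update _
          (((hf (k + e)).continuous.comp (continuous_apply _)).prodMk continuous_const)
      have hlim := h.tendsto (fun j => (xb j, ub j))
      have hfix : Function.update (fun j => (xb j, ub j)) (k + e + 1)
          (Function.uncurry (f (k + e)) (xb (k + e), ub (k + e)), ub (k + e + 1)) =
          fun j => (xb j, ub j) := by
        rw [Function.uncurry_apply_pair, ← htraj (k + e)]
        exact Function.update_eq_self (k + e + 1 : ℤ) (fun j => (xb j, ub j))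
      rwa [hfix] at hlim
    filter_upwards [ih _ (hc hN)] with w hw
    obtain ⟨z, hz, rfl, hsol⟩ := hw
    refine ⟨_, hz, Function.update_of_ne (by omega) _ _, ?_⟩
    intro j h₁ h₂
    push_cast at h₂
    have hj : j ≠ k + e + 1 := by omega
    rcases eq_or_ne j (k + e) with rfl | hjk
    · simp [Function.uncurry]
    · have hj' : j + 1 ≠ k + e + 1 := by omega
      beta_reduce
      rw [Function.update_of_ne hj, Function.update_of_ne hj']
      exact hsol j h₁ (by omega)

theorem continuous_pairWin {n m q₁ q₂ : ℕ} (k : ℤ) :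
    Continuous fun z : ℤ → Vec n × Vec m =>
      pairWin n m q₁ q₂ (fun j => (z j).1) (fun j => (z j).2) k :=
  continuous_pi fun _ => continuous_apply _

theorem continuous_seqWin {m r₁ r₂ : ℕ} (k : ℤ) :
    Continuous fun y : ℤ → Vec m => seqWin m r₁ r₂ y k :=
  continuous_pi fun _ => continuous_apply _

theorem seqWin_congr {m r₁ r₂ : ℕ} {y y' : ℤ → Vec m} {k : ℤ}
    (h : ∀ j : ℤ, k - r₁ ≤ j → j ≤ k + r₂ → y j = y' j) :
    seqWin m r₁ r₂ y k = seqWin m r₁ r₂ y' k := by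
  funext i
  have := i.isLt
  exact h _ (by omega) (by omega)

namespace FlatData

variable {n m : ℕ} {f : ℤ → Vec n → Vec m → Vec n} {xb : ℤ → Vec n} {ub : ℤ → Vec m}
  {q₁ q₂ r₁ r₂ : ℕ} {U : Set (Fin (q₁ + q₂ + 1) → Vec n × Vec m)}
  {V : Set (Fin (r₁ + r₂ + 1) → Vec m)}
  {Φ : ℤ → (Fin (q₁ + q₂ + 1) → Vec n × Vec m) → Vec m}
  {F : ℤ → (Fin (r₁ + r₂ + 1) → Vec m) → Vec n × Vec m}

/-- The flat output depends continuously on the sequence of states and inputs. -/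
theorem tendsto_output (h : FlatData n m f xb ub q₁ q₂ r₁ r₂ U V Φ F) :
    Tendsto (fun (z : ℤ → Vec n × Vec m) (j : ℤ) =>
        Φ j (pairWin n m q₁ q₂ (fun i => (z i).1) (fun i => (z i).2) j))
      (𝓝 (fun j => (xb j, ub j))) (𝓝 (refOut n m q₁ q₂ Φ xb ub)) := by
  refine tendsto_pi_nhds.2 fun j => ?_
  have hΦ : ContinuousAt (Φ j) (pairWin n m q₁ q₂ xb ub j) :=
    (h.smoothPhi j).continuousOn.continuousAt (h.openU.mem_nhds (h.memU j))
  exact hΦ.tendsto.comp ((continuous_pairWin j).tendsto (fun j => (xb j, ub j)))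

theorem eventually_seqWin_mem (h : FlatData n m f xb ub q₁ q₂ r₁ r₂ U V Φ F) (k : ℤ) :
    ∀ᶠ y in 𝓝 (refOut n m q₁ q₂ Φ xb ub), seqWin m r₁ r₂ y k ∈ V :=
  (continuous_seqWin k).continuousAt.eventually (h.openV.mem_nhds (h.memV k))

theorem eventually_pairWin_mem (h : FlatData n m f xb ub q₁ q₂ r₁ r₂ U V Φ F) (k : ℤ) :
    ∀ᶠ z : ℤ → Vec n × Vec m in 𝓝 (fun j => (xb j, ub j)),
      pairWin n m q₁ q₂ (fun j => (z j).1) (fun j => (z j).2) k ∈ U :=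
  (continuous_pairWin k).continuousAt.eventually (h.openU.mem_nhds (h.memU k))

/-- The state component of the parameterization attains every state near the reference state,
already on output sequences close to the reference output. -/
theorem eventually_exists_output (h : FlatData n m f xb ub q₁ q₂ r₁ r₂ U V Φ F)
    (hf : ∀ k : ℤ, ContDiff ℝ (⊤ : ℕ∞) (Function.uncurry (f k)))
    (hsub : IsSubmersiveAlong n m f xb ub) (k : ℤ)
    {p : (ℤ → Vec m) → Prop} (hp : ∀ᶠ y in 𝓝 (refOut n m q₁ q₂ Φ xb ub), p y) :
    ∀ᶠ x in 𝓝 (xb k), ∃ y, p y ∧ (F k (seqWin m r₁ r₂ y k)).1 = x := by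
  have hU : ∀ᶠ z : ℤ → Vec n × Vec m in 𝓝 (fun j => (xb j, ub j)),
      ∀ j ∈ Finset.Icc (k - r₁) (k + r₂),
        pairWin n m q₁ q₂ (fun i => (z i).1) (fun i => (z i).2) j ∈ U :=
    (Filter.eventually_all_finset _).2 fun j _ => h.eventually_pairWin_mem j
  have hN := hU.and (h.tendsto_output.eventually (hp.and (h.eventually_seqWin_mem k)))
  have hw := hsub.eventually_exists_solvesOn hf h.traj k (r₁ + q₁) (r₂ + q₂) _ hN
  have hcont : Tendsto (fun x : Vec n => (x, ub k)) (𝓝 (xb k)) (𝓝 (xb k, ub k)) :=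
    (continuous_id.prodMk continuous_const).tendsto (xb k)
  filter_upwards [hcont.eventually hw] with x hx
  obtain ⟨z, ⟨hzU, hzp, hzV⟩, hzk, hsol⟩ := hx
  refine ⟨_, hzp, ?_⟩
  have hF := h.F4 k (fun i => (z i).1) (fun i => (z i).2)
    (fun j h₁ h₂ => hsol j (by push_cast; omega) (by push_cast; omega))
    (fun j h₁ h₂ => hzU j (Finset.mem_Icc.2 ⟨h₁, h₂⟩)) hzV
  rw [← hF, hzk]

/-- An output sequence all of whose windows are admissible generates a trajectory. -/
theorem isTrajectory_of_seqWin_mem (h : FlatData n m f xb ub q₁ q₂ r₁ r₂ U V Φ F)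
    {y : ℤ → Vec m} (hy : ∀ k, seqWin m r₁ r₂ y k ∈ V) :
    IsTrajectory n m f (fun k => (F k (seqWin m r₁ r₂ y k)).1)
      (fun k => (F k (seqWin m r₁ r₂ y k)).2) :=
  fun k => h.F2 k y (hy k) (hy (k + 1))

end FlatData

/-- The sequence equal to `y₁` on `s₁`, to `y₂` on `s₂` outside `s₁`, and to `y₀` elsewhere. -/
def splice {m : ℕ} (s₁ s₂ : Finset ℤ) (y₀ y₁ y₂ : ℤ → Vec m) : ℤ → Vec m :=
  fun j => if j ∈ s₁ then y₁ j else if j ∈ s₂ then y₂ j else y₀ j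

theorem tendsto_splice {m : ℕ} (s₁ s₂ : Finset ℤ) (y₀ : ℤ → Vec m) :
    Tendsto (fun p : (ℤ → Vec m) × (ℤ → Vec m) => splice s₁ s₂ y₀ p.1 p.2)
      (𝓝 y₀ ×ˢ 𝓝 y₀) (𝓝 y₀) := by
  have h : Continuous fun p : (ℤ → Vec m) × (ℤ → Vec m) => splice s₁ s₂ y₀ p.1 p.2 := by
    refine continuous_pi fun j => ?_
    unfold splice
    split_ifs <;> fun_prop
  have hlim := h.tendsto (y₀, y₀)
  have hself : splice s₁ s₂ y₀ y₀ y₀ = y₀ := funext fun j => by simp [splice]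
  rwa [nhds_prod_eq, hself] at hlim

/-- Flat systems are locally reachable: if `f` is flat and
submersive along `(xb, ub)`, then there is `r : ℕ` such that any state near
`xb kᵢ` can be steered to any state near `xb k_f` whenever `k_f ≥ kᵢ + r`. -/
theorem flat_implies_locally_reachable
    (n m : ℕ) (f : ℤ → Vec n → Vec m → Vec n)
    (hf : ∀ k : ℤ, ContDiff ℝ (⊤ : ℕ∞) (Function.uncurry (f k)))
    (xb : ℤ → Vec n) (ub : ℤ → Vec m)
    (hflat : IsFlatAlong n m f xb ub)
    (hsub : IsSubmersiveAlong n m f xb ub) :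
    ∃ r : ℕ, ∀ (ki : ℤ) (kf : ℤ), ki + r ≤ kf →
      ∃ (Wi Wf : Set (Vec n)), IsOpen Wi ∧ IsOpen Wf ∧
        xb ki ∈ Wi ∧ xb kf ∈ Wf ∧
        ∀ xi ∈ Wi, ∀ xf ∈ Wf,
          ∃ (x : ℤ → Vec n) (u : ℤ → Vec m),
            IsTrajectory n m f x u ∧ x ki = xi ∧ x kf = xf := by
  obtain ⟨q₁, q₂, r₁, r₂, U, V, Φ, F, h⟩ := hflat
  refine ⟨r₁ + r₂ + 1, fun ki kf hk => ?_⟩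
  push_cast at hk
  let yb := refOut n m q₁ q₂ Φ xb ub
  let s₁ := Finset.Icc (ki - r₁) (ki + r₂)
  let s₂ := Finset.Icc (kf - r₁) (kf + r₂)
  have hV : ∀ᶠ y in 𝓝 yb,
      ∀ k ∈ Finset.Icc (ki - r₁ - r₂) (kf + r₁ + r₂), seqWin m r₁ r₂ y k ∈ V :=
    (Filter.eventually_all_finset _).2 fun k _ => h.eventually_seqWin_mem k
  obtain ⟨p₁, hp₁, p₂, hp₂, hp⟩ :=
    eventually_prod_iff.1 ((tendsto_splice s₁ s₂ yb).eventually hV)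
  obtain ⟨Wi, hWi, hWio, hxi⟩ := eventually_nhds_iff.1 (h.eventually_exists_output hf hsub ki hp₁)
  obtain ⟨Wf, hWf, hWfo, hxf⟩ := eventually_nhds_iff.1 (h.eventually_exists_output hf hsub kf hp₂)
  refine ⟨Wi, Wf, hWio, hWfo, hxi, hxf, fun xi hxiW xf hxfW => ?_⟩
  obtain ⟨y₁, hy₁, hy₁x⟩ := hWi xi hxiW
  obtain ⟨y₂, hy₂, hy₂x⟩ := hWf xf hxfW
  have hmem := hp hy₁ hy₂
  have hall : ∀ k, seqWin m r₁ r₂ (splice s₁ s₂ yb y₁ y₂) k ∈ V := by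
    intro k
    by_cases hkm : k ∈ Finset.Icc (ki - r₁ - r₂) (kf + r₁ + r₂)
    · exact hmem k hkm
    · rw [Finset.mem_Icc] at hkm
      rw [seqWin_congr (y' := yb)]
      · exact h.memV k
      · intro j h₁ h₂
        have hj₁ : j ∉ s₁ := by simp only [s₁, Finset.mem_Icc]; omega
        have hj₂ : j ∉ s₂ := by simp only [s₂, Finset.mem_Icc]; omega
        simp [splice, hj₁, hj₂]
  refine ⟨_, _, h.isTrajectory_of_seqWin_mem hall, ?_, ?_⟩
  · rw [← hy₁x]
    rw [seqWin_congr (y' := y₁)]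
    intro j h₁ h₂
    have hj₁ : j ∈ s₁ := Finset.mem_Icc.2 ⟨h₁, h₂⟩
    simp [splice, hj₁]
  · rw [← hy₂x]
    rw [seqWin_congr (y' := y₂)]
    intro j h₁ h₂
    have hj₁ : j ∉ s₁ := by simp only [s₁, Finset.mem_Icc]; omega
    have hj₂ : j ∈ s₂ := Finset.mem_Icc.2 ⟨h₁, h₂⟩
    simp [splice, hj₁, hj₂]

end
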